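/- Let K ≥ 1, let θ ∈ ℝ^K be a probability vector (θ_k ≥ 0, Σ_k θ_k = 1) with all θ_k > 0, let α > 0, and for each class k ∈ {1,…,K} let the likelihood of observing y ∈ ℝ^K be the Gaussian density g_k(y) := (2παK)^{−K/2} exp(−‖y − α(K e_k − 𝟙)‖²/(2αK)), where e_k is the k-th standard basis vector and 𝟙 = (1,…,1). Then the Bayesian posterior over classes equals the softmax-reweighted prior: for every k, (θ_k g_k(y)) / (Σ_{j=1}^{K} θ_j g_j(y)) = (e^{y_k} θ_k) / (Σ_{j=1}^{K} e^{y_j} θ_j). -/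

import Mathlib

open scoped BigOperators

/-- for the categorical Bayesian update of the BFN, with Gaussian class
likelihoods `g_k(y) = (2παK)^{-K/2} exp(-‖y - α(K e_k - 𝟙)‖²/(2αK))`, the Bayesian
posterior over classes is the softmax-reweighted prior. -/
theorem stmt_4 (K : ℕ) (hK : 1 ≤ K) (θ : Fin K → ℝ) (hθpos : ∀ k, 0 < θ k)
    (hθsum : ∑ k, θ k = 1) (α : ℝ) (hα : 0 < α) (y : Fin K → ℝ)
    (g : Fin K → ℝ)
    (hg : ∀ k, g k = (2 * Real.pi * α * K) ^ (-(K : ℝ) / 2) *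
      Real.exp (-(∑ j, (y j - α * ((K : ℝ) * (if j = k then 1 else 0) - 1)) ^ 2)
        / (2 * α * K))) :
    ∀ k, θ k * g k / (∑ j, θ j * g j)
        = Real.exp (y k) * θ k / (∑ j, Real.exp (y j) * θ j) := by
  have hKpos : (0 : ℝ) < K := by exact_mod_cast hK
  obtain ⟨C, hC, hgC⟩ : ∃ C : ℝ, 0 < C ∧ ∀ k, g k = C * Real.exp (y k) := by
    refine ⟨(2 * Real.pi * α * K) ^ (-(K : ℝ) / 2) *
      Real.exp (α - α * K / 2 - (∑ j, (y j + α) ^ 2) / (2 * α * K)), ?_, ?_⟩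
    · have := Real.pi_pos
      positivity
    · intro k
      have hs : ∑ j, (y j - α * ((K : ℝ) * (if j = k then 1 else 0) - 1)) ^ 2
          = ∑ j, (y j + α) ^ 2 - (2 * α * K * (y k + α) - α ^ 2 * K ^ 2) := by
        have h1 : ∀ j, (y j - α * ((K : ℝ) * (if j = k then 1 else 0) - 1)) ^ 2
            = (y j + α) ^ 2
              - (if j = k then (2 * α * K * (y j + α) - α ^ 2 * K ^ 2) else 0) := by
          intro j
          split_ifs <;> ring
        simp only [h1, Finset.sum_sub_distrib, Finset.sum_ite_eq', Finset.sum_ite_eq,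
          Finset.mem_univ, if_true]
      rw [hg k, hs, mul_assoc (_ ^ _) (Real.exp _) (Real.exp _), ← Real.exp_add]
      congr 2
      field_simp
      ring
  intro k
  have hsum : ∑ j, θ j * g j = C * ∑ j, Real.exp (y j) * θ j := by
    rw [Finset.mul_sum]
    refine Finset.sum_congr rfl fun j _ => ?_
    rw [hgC j]
    ring
  rw [hsum, hgC k, show θ k * (C * Real.exp (y k)) = C * (Real.exp (y k) * θ k) by ring,
    mul_div_mul_left _ _ hC.ne']
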